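/- arXiv:1907.07542 — 6 statements merged into one kernel-verified Lean document; each statement's English description precedes it below -/
import Mathlib

section
/- Let n ≥ 1, K > 0, and let L : ℝ × ℝⁿ × ℝⁿ × ℝ → ℝ be C¹ with |∂L/∂u| ≤ K everywhere. Let φ : ℝⁿ → ℝ, t > 0 and x ∈ ℝⁿ. For ξ ∈ A_{t,x} let u_ξ be the Carathéodory solution on [0,t] with u_ξ(0) = φ(ξ(0)), and write L_u(s) := (∂L/∂u)(s,ξ(s),ξ'(s),u_ξ(s)). Then, as elements of ℝ ∪ {−∞}, inf over ξ ∈ A_{t,x} of u_ξ(t) equals inf over ξ ∈ A_{t,x} of ( exp(∫₀^{t} L_u(τ) dτ)·φ(ξ(0)) + ∫₀^{t} exp(∫_{s}^{t} L_u(τ) dτ)·( L(s,ξ(s),ξ'(s),u_ξ(s)) − u_ξ(s)·L_u(s) ) ds ). -/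
open MeasureTheory Set

noncomputable section

/-- A Lipschitz curve `ξ : [a,b] → ℝⁿ`, with `ξ'` its a.e. derivative. -/
def IsLipCurve (n : ℕ) (a b : ℝ) (ξ ξ' : ℝ → EuclideanSpace ℝ (Fin n)) : Prop :=
  (∃ C : NNReal, LipschitzOnWith C ξ (Icc a b)) ∧
  IntervalIntegrable ξ' volume a b ∧
  ∀ s ∈ Icc a b, ξ s = ξ a + ∫ τ in a..s, ξ' τ

/-- `w` is the Carathéodory solution on `[a,b]` along `(ξ,ξ')` with initial value `u₀`. -/
def IsCaraSol (n : ℕ) (L : ℝ → EuclideanSpace ℝ (Fin n) → EuclideanSpace ℝ (Fin n) → ℝ → ℝ)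
    (a b : ℝ) (ξ ξ' : ℝ → EuclideanSpace ℝ (Fin n)) (u₀ : ℝ) (w : ℝ → ℝ) : Prop :=
  ContinuousOn w (Icc a b) ∧
  IntervalIntegrable (fun τ => L τ (ξ τ) (ξ' τ) (w τ)) volume a b ∧
  ∀ s ∈ Icc a b, w s = u₀ + ∫ τ in a..s, L τ (ξ τ) (ξ' τ) (w τ)

/-- Postcomposing an absolutely continuous function with a Lipschitz function gives an absolutely
continuous function. -/
theorem LipschitzOnWith.comp_absolutelyContinuousOnInterval {X Y : Type*} [PseudoMetricSpace X]
    [PseudoMetricSpace Y] {C : NNReal} {g : X → Y} {S : Set X} {f : ℝ → X} {a b : ℝ}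
    (hg : LipschitzOnWith C g S) (hf : AbsolutelyContinuousOnInterval f a b)
    (hS : MapsTo f (uIcc a b) S) : AbsolutelyContinuousOnInterval (g ∘ f) a b := by
  rw [absolutelyContinuousOnInterval_iff] at hf ⊢
  intro ε hε
  obtain ⟨δ, hδ, h⟩ := hf (ε / (C + 1)) (by positivity)
  refine ⟨δ, hδ, fun E hE hlt => ?_⟩
  calc
    _ ≤ ∑ i ∈ Finset.range E.1, C * dist (f (E.2 i).1) (f (E.2 i).2) :=
      Finset.sum_le_sum fun i hi =>
        hg.dist_le_mul _ (hS (hE.1 i hi).1) _ (hS (hE.1 i hi).2)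
    _ = C * ∑ i ∈ Finset.range E.1, dist (f (E.2 i).1) (f (E.2 i).2) := by
      rw [Finset.mul_sum]
    _ ≤ C * (ε / (C + 1)) := by gcongr; exact (h E hE hlt).le
    _ < ε := by
      rw [mul_div_assoc', div_lt_iff₀ (by positivity)]
      nlinarith

theorem AbsolutelyContinuousOnInterval.exp {f : ℝ → ℝ} {a b : ℝ}
    (hf : AbsolutelyContinuousOnInterval f a b) :
    AbsolutelyContinuousOnInterval (fun s => Real.exp (f s)) a b := by
  obtain ⟨C, hC⟩ := hf.exists_bound
  obtain ⟨M, hM⟩ := (Real.contDiff_exp.contDiffOn (n := 1)).exists_lipschitzOnWith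
    (by decide) (convex_Icc (-C) C) isCompact_Icc
  exact hM.comp_absolutelyContinuousOnInterval hf fun s hs => abs_le.1 (hC s hs)

/-- Variation of constants with integrable data: if `u` is a primitive of `f`, then for any
integrable `ℓ`, `u` solves the linear equation `u' = ℓ u + (f - u ℓ)` in integrated form. -/
theorem eq_exp_integral_mul_add_integral_of_primitive {u f l : ℝ → ℝ} {a b u₀ : ℝ}
    (hf : IntervalIntegrable f volume a b) (hl : IntervalIntegrable l volume a b)
    (hu : ∀ s ∈ uIcc a b, u s = u₀ + ∫ τ in a..s, f τ) :
    u b = Real.exp (∫ τ in a..b, l τ) * u₀ +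
      ∫ s in a..b, Real.exp (∫ τ in s..b, l τ) * (f s - u s * l s) := by
  let v : ℝ → ℝ := fun s => (∫ τ in a..s, f τ) + u₀
  let e : ℝ → ℝ := fun s => Real.exp (-∫ τ in b..s, l τ)
  have hv : AbsolutelyContinuousOnInterval v a b :=
    (hf.absolutelyContinuousOnInterval_intervalIntegral (c := a) left_mem_uIcc).add
      (LipschitzWith.const u₀).lipschitzOnWith.absolutelyContinuousOnInterval
  have he : AbsolutelyContinuousOnInterval e a b :=
    (hl.absolutelyContinuousOnInterval_intervalIntegral (c := b) right_mem_uIcc).neg.exp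
  have key := he.integral_deriv_mul_eq_sub hv
  have hcongr : ∫ s in a..b, deriv e s * v s + e s * deriv v s =
      ∫ s in a..b, Real.exp (∫ τ in s..b, l τ) * (f s - u s * l s) := by
    apply intervalIntegral.integral_congr_ae
    filter_upwards [hf.ae_hasDerivAt_integral, hl.ae_hasDerivAt_integral] with s hs₁ hs₂ hs
    have hs' := uIoc_subset_uIcc hs
    have h₁ : HasDerivAt v (f s) s := (hs₁ hs' a left_mem_uIcc).add_const u₀
    have h₂ : HasDerivAt e (e s * -l s) s := (hs₂ hs' b right_mem_uIcc).neg.exp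
    rw [h₁.deriv, h₂.deriv, intervalIntegral.integral_symm b s, hu s hs']
    simp only [e, v]
    ring
  rw [← hcongr, key, hu b right_mem_uIcc]
  simp only [e, v, intervalIntegral.integral_same, neg_zero, Real.exp_zero]
  rw [intervalIntegral.integral_symm a b, neg_neg]
  ring

/-- A partial derivative in the last variable of a `C¹` function is jointly continuous. -/
theorem continuous_partial_of_contDiff {E : Type*} [NormedAddCommGroup E] [NormedSpace ℝ E]
    {F F' : E × ℝ → ℝ} (hF : ContDiff ℝ 1 F)
    (hF' : ∀ p : E × ℝ, HasDerivAt (fun r => F (p.1, r)) (F' p) p.2) : Continuous F' := by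
  have h : F' = fun p => fderiv ℝ F p (0, 1) := by
    funext p
    have h₁ : HasFDerivAt F (fderiv ℝ F p) (p.1, p.2) :=
      (hF.differentiable one_ne_zero p).hasFDerivAt
    have h₂ : HasDerivAt (fun r : ℝ => (p.1, r)) ((0 : E), (1 : ℝ)) p.2 :=
      (hasDerivAt_const p.2 p.1).prodMk (hasDerivAt_id p.2)
    exact (hF' p).unique (h₁.comp_hasDerivAt p.2 h₂)
  rw [h]
  exact (hF.continuous_fderiv one_ne_zero).clm_apply continuous_const

/-- **Representation formula II**: for a `C¹` Lagrangian with `|∂L/∂u| ≤ K`,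
`inf_{ξ ∈ A_{t,x}} u_ξ(t)` equals, in `ℝ ∪ {−∞}`, the infimum over `ξ ∈ A_{t,x}` of
`e^{∫₀ᵗ L_u} φ(ξ(0)) + ∫₀ᵗ e^{∫ₛᵗ L_u} (L − u_ξ L_u) ds`, where
`L_u(s) = ∂L/∂u (s,ξ(s),ξ'(s),u_ξ(s))`. -/
theorem representation_formula_II
    (n : ℕ) (hn : 1 ≤ n) (K : ℝ) (hK : 0 < K)
    (L Lu : ℝ → EuclideanSpace ℝ (Fin n) → EuclideanSpace ℝ (Fin n) → ℝ → ℝ)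
    (hLC1 : ContDiff ℝ 1 fun p : ℝ × EuclideanSpace ℝ (Fin n) × EuclideanSpace ℝ (Fin n) × ℝ =>
      L p.1 p.2.1 p.2.2.1 p.2.2.2)
    (hLu : ∀ (s : ℝ) (x v : EuclideanSpace ℝ (Fin n)) (u : ℝ),
      HasDerivAt (fun r => L s x v r) (Lu s x v u) u)
    (hLuK : ∀ (s : ℝ) (x v : EuclideanSpace ℝ (Fin n)) (u : ℝ), |Lu s x v u| ≤ K)
    (φ : EuclideanSpace ℝ (Fin n) → ℝ) (t : ℝ) (ht : 0 < t) (x : EuclideanSpace ℝ (Fin n))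
    (usol : (ℝ → EuclideanSpace ℝ (Fin n)) → (ℝ → EuclideanSpace ℝ (Fin n)) → ℝ → ℝ)
    (husol : ∀ ξ ξ', IsLipCurve n 0 t ξ ξ' →
      IsCaraSol n L 0 t ξ ξ' (φ (ξ 0)) (usol ξ ξ')) :
    (⨅ p : {p : (ℝ → EuclideanSpace ℝ (Fin n)) × (ℝ → EuclideanSpace ℝ (Fin n)) //
        IsLipCurve n 0 t p.1 p.2 ∧ p.1 t = x},
      ((usol p.1.1 p.1.2 t : ℝ) : EReal)) =
    ⨅ p : {p : (ℝ → EuclideanSpace ℝ (Fin n)) × (ℝ → EuclideanSpace ℝ (Fin n)) //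
        IsLipCurve n 0 t p.1 p.2 ∧ p.1 t = x},
      (((Real.exp (∫ τ in (0:ℝ)..t, Lu τ (p.1.1 τ) (p.1.2 τ) (usol p.1.1 p.1.2 τ)) *
            φ (p.1.1 0) +
          ∫ s in (0:ℝ)..t,
            Real.exp (∫ τ in s..t, Lu τ (p.1.1 τ) (p.1.2 τ) (usol p.1.1 p.1.2 τ)) *
              (L s (p.1.1 s) (p.1.2 s) (usol p.1.1 p.1.2 s) -
                usol p.1.1 p.1.2 s * Lu s (p.1.1 s) (p.1.2 s) (usol p.1.1 p.1.2 s))) : ℝ) :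
        EReal) := by
  have hLu_cont : Continuous fun p : ℝ × EuclideanSpace ℝ (Fin n) × EuclideanSpace ℝ (Fin n) × ℝ =>
      Lu p.1 p.2.1 p.2.2.1 p.2.2.2 := by
    have h := continuous_partial_of_contDiff
      (E := ℝ × EuclideanSpace ℝ (Fin n) × EuclideanSpace ℝ (Fin n))
      (F := fun q => L q.1.1 q.1.2.1 q.1.2.2 q.2) (F' := fun q => Lu q.1.1 q.1.2.1 q.1.2.2 q.2)
      (hLC1.comp (f := fun q : (ℝ × EuclideanSpace ℝ (Fin n) × EuclideanSpace ℝ (Fin n)) × ℝ =>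
        (q.1.1, q.1.2.1, q.1.2.2, q.2)) (by fun_prop)) (fun q => hLu q.1.1 q.1.2.1 q.1.2.2 q.2)
    exact h.comp (f := fun p : ℝ × EuclideanSpace ℝ (Fin n) × EuclideanSpace ℝ (Fin n) × ℝ =>
      ((p.1, p.2.1, p.2.2.1), p.2.2.2)) (by fun_prop)
  refine iInf_congr fun ⟨⟨ξ, ξ'⟩, hξ, _⟩ => ?_
  obtain ⟨hu_cont, hL_int, hu⟩ := husol ξ ξ' hξ
  obtain ⟨⟨C, hC⟩, hξ'_int, -⟩ := hξ
  have hl : IntervalIntegrable (fun τ => Lu τ (ξ τ) (ξ' τ) (usol ξ ξ' τ)) volume 0 t := by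
    refine (intervalIntegrable_const (c := K)).mono_fun ?_ ?_
    · rw [uIoc_of_le ht.le]
      refine hLu_cont.comp_aestronglyMeasurable
        (f := fun τ => (τ, ξ τ, ξ' τ, usol ξ ξ' τ)) ?_
      refine aestronglyMeasurable_id.prodMk (.prodMk ?_ (.prodMk ?_ ?_))
      · exact (hC.continuousOn.mono Ioc_subset_Icc_self).aestronglyMeasurable measurableSet_Ioc
      · exact hξ'_int.aestronglyMeasurable
      · exact (hu_cont.mono Ioc_subset_Icc_self).aestronglyMeasurable measurableSet_Ioc
    · exact .of_forall fun τ => (hLuK _ _ _ _).trans (le_abs_self K)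
  exact congrArg _ (eq_exp_integral_mul_add_integral_of_primitive hL_int hl
    (by rwa [uIcc_of_le ht.le]))
end
end

section
/- Let n ≥ 1, K > 0, and let L : ℝ × ℝⁿ × ℝⁿ × ℝ → ℝ be C¹ with |∂L/∂u| ≤ K everywhere and with u ↦ L(s,x,v,u) concave for every (s,x,v). Fix t₁ < t₂, x, y ∈ ℝⁿ and u₀ ∈ ℝ. For ξ ∈ Γ^{t₁,t₂}_{x,y} let u_ξ be the Carathéodory solution with u_ξ(t₁) = u₀. Suppose ξ* ∈ Γ^{t₁,t₂}_{x,y} attains the infimum of ξ ↦ u_ξ(t₂) over Γ^{t₁,t₂}_{x,y}. For η ∈ Γ^{t₁,t₂}_{x,y} let v_η : [t₁,t₂] → ℝ be the unique continuous solution of v_η(s) = u₀ + ∫_{t₁}^{s} [ L(τ,η(τ),η'(τ),u_{ξ*}(τ)) + (∂L/∂u)(τ,η(τ),η'(τ),u_{ξ*}(τ))·(v_η(τ) − u_{ξ*}(τ)) ] dτ. Then inf over ξ ∈ Γ^{t₁,t₂}_{x,y} of u_ξ(t₂) equals inf over η ∈ Γ^{t₁,t₂}_{x,y} of v_η(t₂).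 -/
open MeasureTheory Set

noncomputable section

/-- Integral form of Grönwall's inequality for a nonnegative function with zero initial bound. -/
theorem nonpos_of_le_mul_integral {g : ℝ → ℝ} {a b K : ℝ} (hab : a ≤ b) (hg : Continuous g)
    (hg0 : ∀ s ∈ Icc a b, 0 ≤ g s) (hgK : ∀ s ∈ Icc a b, g s ≤ K * ∫ τ in a..s, g τ) :
    g b ≤ 0 := by
  have hderiv : ∀ s, HasDerivAt (fun r => ∫ τ in a..r, g τ) (g s) s := fun s =>
    intervalIntegral.integral_hasDerivAt_right (hg.intervalIntegrable _ _)
      hg.stronglyMeasurable.stronglyMeasurableAtFilter hg.continuousAt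
  have hzero := eq_zero_of_abs_deriv_le_mul_abs_self_of_eq_zero_right (K := K) (b := b)
    (fun s _ => (hderiv s).continuousAt.continuousWithinAt)
    (fun s _ => (hderiv s).hasDerivWithinAt) intervalIntegral.integral_same
    (fun s hs => by
      have hint : 0 ≤ ∫ τ in a..s, g τ :=
        intervalIntegral.integral_nonneg hs.1 fun τ hτ => hg0 τ ⟨hτ.1, hτ.2.trans hs.2.le⟩
      rw [Real.norm_of_nonneg (hg0 s (Ico_subset_Icc_self hs)), Real.norm_of_nonneg hint]
      exact hgK s (Ico_subset_Icc_self hs))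
    b (right_mem_Icc.2 hab)
  simpa [hzero] using hgK b (right_mem_Icc.2 hab)

/-- Comparison principle: an absolutely continuous function vanishing at `a` whose derivative is
bounded above by `K` times its absolute value is nonpositive. -/
theorem nonpos_of_integral_of_le_mul_abs {d f : ℝ → ℝ} {a b K : ℝ} (hab : a ≤ b)
    (hd : ContinuousOn d (Icc a b)) (hf : IntervalIntegrable f volume a b)
    (hdf : ∀ s ∈ Icc a b, d s = ∫ τ in a..s, f τ)
    (hfK : ∀ s ∈ Icc a b, f s ≤ K * |d s|) : d b ≤ 0 := by
  by_contra! hb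
  have hclosed : IsClosed {s ∈ Icc a b | d s ≤ 0} :=
    isClosed_Icc.isClosed_le hd continuousOn_const
  have hbdd : BddAbove {s ∈ Icc a b | d s ≤ 0} := ⟨b, fun s hs => hs.1.2⟩
  have ha : a ∈ {s ∈ Icc a b | d s ≤ 0} :=
    ⟨left_mem_Icc.2 hab, by simp [hdf a (left_mem_Icc.2 hab)]⟩
  set c := sSup {s ∈ Icc a b | d s ≤ 0}
  obtain ⟨hc, hdc⟩ : c ∈ {s ∈ Icc a b | d s ≤ 0} := hclosed.csSup_mem ⟨a, ha⟩ hbdd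
  have hpos : ∀ s ∈ Ioc c b, 0 < d s := fun s hs => by
    by_contra! hs'
    exact (le_csSup hbdd ⟨⟨hc.1.trans hs.1.le, hs.2⟩, hs'⟩).not_gt hs.1
  have hsub : Icc c b ⊆ Icc a b := Icc_subset_Icc_left hc.1
  have hdc0 : 0 ≤ d c := by
    rcases hc.2.eq_or_lt with h | h
    · exact h ▸ hb.le
    · have hcl : c ∈ closure (Ioc c b) := by
        rw [closure_Ioc h.ne]; exact left_mem_Icc.2 h.le
      have := mem_closure_iff_nhdsWithin_neBot.1 hcl
      exact ge_of_tendsto ((hd c hc).mono (Ioc_subset_Icc_self.trans hsub)).tendsto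
        (eventually_nhdsWithin_of_forall fun s hs => (hpos s hs).le)
  have hnn : ∀ s ∈ Icc c b, 0 ≤ d s := fun s hs =>
    hs.1.eq_or_lt.elim (fun h => h ▸ hdc0) fun h => (hpos s ⟨h, hs.2⟩).le
  have hext : ∀ s ∈ Icc c b, IccExtend hc.2 (domRestrict (Icc c b) d) s = d s := fun s hs =>
    IccExtend_of_mem _ _ hs
  have hcont : Continuous (IccExtend hc.2 (domRestrict (Icc c b) d)) :=
    (hd.mono hsub).domRestrict.Icc_extend'
  have hle := nonpos_of_le_mul_integral (K := K) hc.2 hcont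
    (fun s hs => by rw [hext s hs]; exact hnn s hs) fun s hs => by
      have hint : ∀ r ∈ Icc a b, ∀ t ∈ Icc a b, IntervalIntegrable f volume r t :=
        fun r hr t ht => hf.mono_set (by rw [uIcc_of_le hab]; exact uIcc_subset_Icc hr ht)
      have hadd := intervalIntegral.integral_add_adjacent_intervals
        (hint a (left_mem_Icc.2 hab) c hc) (hint c hc s (hsub hs))
      rw [← hdf c hc, ← hdf s (hsub hs)] at hadd
      rw [hext s hs, ← intervalIntegral.integral_const_mul]
      calc d s ≤ ∫ τ in c..s, f τ := by linarith
        _ ≤ _ := intervalIntegral.integral_mono_on hs.1 (hint c hc s (hsub hs))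
          ((hcont.const_mul K).intervalIntegrable _ _) fun τ hτ => by
            have hτ' : τ ∈ Icc c b := ⟨hτ.1, hτ.2.trans hs.2⟩
            rw [hext τ hτ', ← abs_of_nonneg (hnn τ hτ')]
            simpa using hfK τ (hsub hτ')
  rw [hext b (right_mem_Icc.2 hc.2)] at hle
  exact hle.not_gt hb

/-- A concave function on the line lies below its tangents. -/
theorem ConcaveOn.le_tangent {f : ℝ → ℝ} {f' p : ℝ} (hf : ConcaveOn ℝ univ f)
    (hp : HasDerivAt f f' p) (q : ℝ) : f q ≤ f p + f' * (q - p) := by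
  rcases lt_trichotomy p q with h | rfl | h
  · have := hf.slope_le_of_hasDerivAt (mem_univ p) (mem_univ q) h hp
    rw [slope_def_field, div_le_iff₀ (sub_pos.2 h)] at this
    linarith
  · simp
  · have := hf.le_slope_of_hasDerivAt (mem_univ q) (mem_univ p) h hp
    rw [slope_def_field, le_div_iff₀ (sub_pos.2 h)] at this
    linarith

/-- A function on the line whose derivative is bounded by `K` is `K`-Lipschitz. -/
theorem sub_le_mul_abs_sub_of_abs_deriv_le {f f' : ℝ → ℝ} {K : ℝ}
    (hf : ∀ r, HasDerivAt f (f' r) r) (hK : ∀ r, |f' r| ≤ K) (p q : ℝ) :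
    f q - f p ≤ K * |q - p| :=
  (le_abs_self _).trans <| convex_univ.norm_image_sub_le_of_norm_hasDerivWithin_le
    (fun r _ => (hf r).hasDerivWithinAt) (fun r _ => hK r) (mem_univ p) (mem_univ q)

/-- **Lemma 3.1 (1)**: for a `u`-concave Lagrangian, if `ξ*` minimizes `ξ ↦ u_ξ(t₂)` over
`Γ^{t₁,t₂}_{x,y}`, and `v_η` solves the Carathéodory equation for the Lagrangian linearized
in `u` around `u_{ξ*}`, then `inf_ξ u_ξ(t₂) = inf_η v_η(t₂)`. -/
theorem linearized_herglotz_inf_eq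
    (n : ℕ) (hn : 1 ≤ n) (K : ℝ) (hK : 0 < K)
    (L Lu : ℝ → EuclideanSpace ℝ (Fin n) → EuclideanSpace ℝ (Fin n) → ℝ → ℝ)
    (hLC1 : ContDiff ℝ 1 fun p : ℝ × EuclideanSpace ℝ (Fin n) × EuclideanSpace ℝ (Fin n) × ℝ =>
      L p.1 p.2.1 p.2.2.1 p.2.2.2)
    (hLu : ∀ (s : ℝ) (x v : EuclideanSpace ℝ (Fin n)) (u : ℝ),
      HasDerivAt (fun r => L s x v r) (Lu s x v u) u)
    (hLuK : ∀ (s : ℝ) (x v : EuclideanSpace ℝ (Fin n)) (u : ℝ), |Lu s x v u| ≤ K)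
    (hconc : ∀ (s : ℝ) (x v : EuclideanSpace ℝ (Fin n)),
      ConcaveOn ℝ univ fun u : ℝ => L s x v u)
    (t₁ t₂ : ℝ) (ht : t₁ < t₂) (x y : EuclideanSpace ℝ (Fin n)) (u₀ : ℝ)
    (usol : (ℝ → EuclideanSpace ℝ (Fin n)) → (ℝ → EuclideanSpace ℝ (Fin n)) → ℝ → ℝ)
    (husol : ∀ ξ ξ', IsLipCurve n t₁ t₂ ξ ξ' → ξ t₁ = x → ξ t₂ = y →
      IsCaraSol n L t₁ t₂ ξ ξ' u₀ (usol ξ ξ'))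
    (ξs ξs' : ℝ → EuclideanSpace ℝ (Fin n))
    (hξs : IsLipCurve n t₁ t₂ ξs ξs' ∧ ξs t₁ = x ∧ ξs t₂ = y)
    (hmin : ∀ p : {p : (ℝ → EuclideanSpace ℝ (Fin n)) × (ℝ → EuclideanSpace ℝ (Fin n)) //
        IsLipCurve n t₁ t₂ p.1 p.2 ∧ p.1 t₁ = x ∧ p.1 t₂ = y},
      usol ξs ξs' t₂ ≤ usol p.1.1 p.1.2 t₂)
    (vsol : (ℝ → EuclideanSpace ℝ (Fin n)) → (ℝ → EuclideanSpace ℝ (Fin n)) → ℝ → ℝ)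
    (hvsol : ∀ η η', IsLipCurve n t₁ t₂ η η' → η t₁ = x → η t₂ = y →
      ContinuousOn (vsol η η') (Icc t₁ t₂) ∧
      IntervalIntegrable (fun τ => L τ (η τ) (η' τ) (usol ξs ξs' τ) +
        Lu τ (η τ) (η' τ) (usol ξs ξs' τ) * (vsol η η' τ - usol ξs ξs' τ)) volume t₁ t₂ ∧
      ∀ s ∈ Icc t₁ t₂, vsol η η' s = u₀ + ∫ τ in t₁..s,
        (L τ (η τ) (η' τ) (usol ξs ξs' τ) +
          Lu τ (η τ) (η' τ) (usol ξs ξs' τ) * (vsol η η' τ - usol ξs ξs' τ))) :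
    (⨅ p : {p : (ℝ → EuclideanSpace ℝ (Fin n)) × (ℝ → EuclideanSpace ℝ (Fin n)) //
        IsLipCurve n t₁ t₂ p.1 p.2 ∧ p.1 t₁ = x ∧ p.1 t₂ = y},
      ((usol p.1.1 p.1.2 t₂ : ℝ) : EReal)) =
    ⨅ p : {p : (ℝ → EuclideanSpace ℝ (Fin n)) × (ℝ → EuclideanSpace ℝ (Fin n)) //
        IsLipCurve n t₁ t₂ p.1 p.2 ∧ p.1 t₁ = x ∧ p.1 t₂ = y},
      ((vsol p.1.1 p.1.2 t₂ : ℝ) : EReal) := by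
  have hL : ∀ ξ ξ', IsLipCurve n t₁ t₂ ξ ξ' → ξ t₁ = x → ξ t₂ = y →
      usol ξ ξ' t₂ ≤ vsol ξ ξ' t₂ := fun ξ ξ' hξ hx hy => by
    obtain ⟨huc, hui, hu⟩ := husol ξ ξ' hξ hx hy
    obtain ⟨hvc, hvi, hv⟩ := hvsol ξ ξ' hξ hx hy
    refine sub_nonpos.1 (nonpos_of_integral_of_le_mul_abs (K := K)
      (d := fun s => usol ξ ξ' s - vsol ξ ξ' s) ht.le (huc.sub hvc) (hui.sub hvi)
      (fun s hs => ?_) fun s _ => ?_)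
    · have hsub : uIcc t₁ s ⊆ uIcc t₁ t₂ := by
        rw [uIcc_of_le hs.1, uIcc_of_le ht.le]; exact Icc_subset_Icc_right hs.2
      rw [intervalIntegral.integral_sub (hui.mono_set hsub) (hvi.mono_set hsub)]
      linarith [hu s hs, hv s hs]
    · have htan := (hconc s (ξ s) (ξ' s)).le_tangent
        (hLu s (ξ s) (ξ' s) (usol ξs ξs' s)) (vsol ξ ξ' s)
      have hlip := sub_le_mul_abs_sub_of_abs_deriv_le (hLu s (ξ s) (ξ' s))
        (hLuK s (ξ s) (ξ' s)) (vsol ξ ξ' s) (usol ξ ξ' s)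
      linarith
  have hs : vsol ξs ξs' t₂ ≤ usol ξs ξs' t₂ := by
    obtain ⟨huc, hui, hu⟩ := husol ξs ξs' hξs.1 hξs.2.1 hξs.2.2
    obtain ⟨hvc, hvi, hv⟩ := hvsol ξs ξs' hξs.1 hξs.2.1 hξs.2.2
    refine sub_nonpos.1 (nonpos_of_integral_of_le_mul_abs (K := K)
      (d := fun s => vsol ξs ξs' s - usol ξs ξs' s) ht.le (hvc.sub huc) (hvi.sub hui)
      (fun s hs => ?_) fun s _ => ?_)
    · have hsub : uIcc t₁ s ⊆ uIcc t₁ t₂ := by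
        rw [uIcc_of_le hs.1, uIcc_of_le ht.le]; exact Icc_subset_Icc_right hs.2
      rw [intervalIntegral.integral_sub (hvi.mono_set hsub) (hui.mono_set hsub)]
      linarith [hu s hs, hv s hs]
    · rw [add_sub_cancel_left]
      refine (le_abs_self _).trans ?_
      rw [abs_mul]
      exact mul_le_mul_of_nonneg_right (hLuK _ _ _ _) (abs_nonneg _)
  refine le_antisymm (iInf_mono fun p => ?_) (le_iInf fun p => ?_)
  · exact EReal.coe_le_coe_iff.2 (hL _ _ p.2.1 p.2.2.1 p.2.2.2)
  · exact (iInf_le _ ⟨(ξs, ξs'), hξs⟩).trans (EReal.coe_le_coe_iff.2 (hs.trans (hmin p)))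
end
end

section
/- Let n ≥ 1, K > 0, and let L : ℝ × ℝⁿ × ℝⁿ × ℝ → ℝ be C¹ with |∂L/∂u| ≤ K everywhere and with u ↦ L(s,x,v,u) concave for every (s,x,v). Fix t₁ < t₂, x, y ∈ ℝⁿ and u₀ ∈ ℝ. For ξ ∈ Γ^{t₁,t₂}_{x,y} let u_ξ be the Carathéodory solution with u_ξ(t₁) = u₀. Suppose ξ* ∈ Γ^{t₁,t₂}_{x,y} attains the infimum of ξ ↦ u_ξ(t₂) over Γ^{t₁,t₂}_{x,y}, and for η ∈ Γ^{t₁,t₂}_{x,y} let v_η : [t₁,t₂] → ℝ be the unique continuous solution of v_η(s) = u₀ + ∫_{t₁}^{s} [ L(τ,η(τ),η'(τ),u_{ξ*}(τ)) + (∂L/∂u)(τ,η(τ),η'(τ),u_{ξ*}(τ))·(v_η(τ) − u_{ξ*}(τ)) ] dτ. Then: (i) ξ* attains the infimum of η ↦ v_η(t₂); (ii) every η' ∈ Γ^{t₁,t₂}_{x,y} attaining the infimum of η ↦ v_η(t₂) also attains the infimum of ξ ↦ u_ξ(t₂); (iii) if ξ* is the unique minimizer of ξ ↦ u_ξ(t₂),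 then the set of minimizers of η ↦ v_η(t₂) equals the set of minimizers of ξ ↦ u_ξ(t₂), and both sets equal {ξ*}. -/
open MeasureTheory Set

noncomputable section

/-- A linear comparison principle: an absolutely continuous function vanishing at `a` stays
nonnegative if its derivative `g` is at least `K * d` wherever `d ≤ 0`. -/
theorem nonneg_of_eq_integral_of_mul_le {d g : ℝ → ℝ} {a b K : ℝ} (hK : 0 < K)
    (hd : ContinuousOn d (Icc a b)) (hg : IntervalIntegrable g volume a b)
    (hdg : ∀ s ∈ Icc a b, d s = ∫ τ in a..s, g τ)
    (hKg : ∀ᵐ τ, τ ∈ Icc a b → d τ ≤ 0 → K * d τ ≤ g τ) :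
    ∀ s ∈ Icc a b, 0 ≤ d s := by
  intro c hc
  by_contra! hneg
  have hab : a ≤ b := hc.1.trans hc.2
  have hda : d a = 0 := by simpa using hdg a (left_mem_Icc.2 hab)
  have hsub : Icc a c ⊆ Icc a b := Icc_subset_Icc_right hc.2
  have hcomp : IsCompact (Icc a c ∩ d ⁻¹' Ici 0) :=
    isCompact_Icc.of_isClosed_subset
      ((hd.mono hsub).preimage_isClosed_of_isClosed isClosed_Icc isClosed_Ici) inter_subset_left
  obtain ⟨r, ⟨hr, hdr⟩, hrmax⟩ := hcomp.exists_isGreatest ⟨a, left_mem_Icc.2 hc.1, hda.ge⟩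
  have hdr0 : 0 ≤ d r := hdr
  have hrc : r < c := lt_of_le_of_ne hr.2 fun h => by rw [h] at hdr0; exact hneg.not_ge hdr0
  have hlt : ∀ s ∈ Ioc r c, d s < 0 := fun s hs => by
    by_contra! h
    exact hs.1.not_ge (hrmax ⟨⟨hr.1.trans hs.1.le, hs.2⟩, h⟩)
  set e := min c (r + 1 / (2 * K))
  have hre : r < e := lt_min hrc (by linarith [show 0 < 1 / (2 * K) by positivity])
  have hec : e ≤ c := min_le_left _ _
  have hsub' : Icc r e ⊆ Icc a b := Icc_subset_Icc hr.1 (hec.trans hc.2)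
  obtain ⟨t, ht, htmin⟩ := isCompact_Icc.exists_isMinOn ⟨e, right_mem_Icc.2 hre.le⟩
    (hd.mono hsub')
  have hdt : d t < 0 :=
    (htmin (right_mem_Icc.2 hre.le) : d t ≤ d e).trans_lt (hlt e ⟨hre, hec⟩)
  have hg_sub : ∀ {p q}, p ∈ Icc a b → q ∈ Icc a b → IntervalIntegrable g volume p q :=
    fun hp hq => hg.mono_set (by
      rw [uIcc_of_le hab]; exact (convex_Icc a b).ordConnected.uIcc_subset hp hq)
  have hr' := hsub hr
  have ht' := hsub' ht
  have hdiff : d t - d r = ∫ τ in r..t, g τ := by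
    rw [hdg t ht', hdg r hr', intervalIntegral.integral_interval_sub_left
      (hg_sub (left_mem_Icc.2 hab) ht') (hg_sub (left_mem_Icc.2 hab) hr')]
  have hle : ∫ _ in r..t, K * d t ≤ ∫ τ in r..t, g τ := by
    refine intervalIntegral.integral_mono_ae_restrict ht.1 intervalIntegrable_const
      (hg_sub hr' ht') ?_
    rw [Filter.EventuallyLE, ae_restrict_iff' measurableSet_Icc]
    filter_upwards [hKg, Measure.ae_ne volume r] with τ hτ hne hI
    have hIe : τ ∈ Icc r e := ⟨hI.1, hI.2.trans ht.2⟩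
    have hmin : d t ≤ d τ := htmin hIe
    have hdτ := hlt τ ⟨hI.1.lt_of_ne' hne, hIe.2.trans hec⟩
    exact (mul_le_mul_of_nonneg_left hmin hK.le).trans (hτ (hsub' hIe) hdτ.le)
  rw [intervalIntegral.integral_const, smul_eq_mul, ← hdiff] at hle
  have hlen : (t - r) * K ≤ 1 / 2 := by
    have : t - r ≤ 1 / (2 * K) := by linarith [ht.2, min_le_right c (r + 1 / (2 * K))]
    calc (t - r) * K ≤ 1 / (2 * K) * K := by gcongr
      _ = 1 / 2 := by field_simp
  nlinarith

/-- Two integrable functions with the same indefinite integral on `[a, b]` agree a.e. there. -/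
theorem ae_eq_of_integral_eq {E : Type*} [NormedAddCommGroup E] [NormedSpace ℝ E]
    [CompleteSpace E] {f g : ℝ → E} {a b : ℝ} (hf : IntervalIntegrable f volume a b)
    (hg : IntervalIntegrable g volume a b)
    (hfg : ∀ s ∈ Icc a b, ∫ τ in a..s, f τ = ∫ τ in a..s, g τ) :
    ∀ᵐ τ, τ ∈ Icc a b → f τ = g τ := by
  filter_upwards [hf.ae_hasDerivAt_integral, hg.ae_hasDerivAt_integral,
    Measure.ae_ne volume a, Measure.ae_ne volume b] with τ hfτ hgτ ha hb hτ
  have hu : uIcc a b = Icc a b := uIcc_of_le (hτ.1.trans hτ.2)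
  rw [hu] at hfτ hgτ
  have haI : a ∈ Icc a b := left_mem_Icc.2 (hτ.1.trans hτ.2)
  refine (hfτ hτ a haI).unique ((hgτ hτ a haI).congr_of_eventuallyEq ?_)
  filter_upwards [Icc_mem_nhds (hτ.1.lt_of_ne' ha) (hτ.2.lt_of_ne hb)] with s hs
  exact hfg s hs

/-- The difference of two functions with the same initial value, given as indefinite integrals. -/
theorem integral_sub_eq {f g F G : ℝ → ℝ} {a b c : ℝ} (hf : IntervalIntegrable f volume a b)
    (hg : IntervalIntegrable g volume a b) (hF : ∀ s ∈ Icc a b, F s = c + ∫ τ in a..s, f τ)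
    (hG : ∀ s ∈ Icc a b, G s = c + ∫ τ in a..s, g τ) :
    ∀ s ∈ Icc a b, (F - G) s = ∫ τ in a..s, (f - g) τ := by
  intro s hs
  have hsub : uIcc a s ⊆ uIcc a b := uIcc_subset_uIcc left_mem_uIcc (Icc_subset_uIcc hs)
  simp only [Pi.sub_apply]
  rw [intervalIntegral.integral_sub (hf.mono_set hsub) (hg.mono_set hsub), hF s hs, hG s hs]
  ring

/-- A concave function on `ℝ` lies below its tangent lines. -/
theorem concave_le_tangent {f : ℝ → ℝ} {f' u : ℝ} (hf : ConcaveOn ℝ univ f)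
    (hf' : HasDerivAt f f' u) (r : ℝ) : f r ≤ f u + f' * (r - u) := by
  rcases lt_trichotomy r u with h | rfl | h
  · have := hf.le_slope_of_hasDerivAt (mem_univ r) (mem_univ u) h hf'
    rw [slope_def_field, le_div_iff₀ (sub_pos.2 h)] at this
    linarith
  · simp
  · have := hf.slope_le_of_hasDerivAt (mem_univ u) (mem_univ r) h hf'
    rw [slope_def_field, div_le_iff₀ (sub_pos.2 h)] at this
    linarith

/-- **Lemma 3.1 (2)**: with `v_η` the solution of the Carathéodory equation for the Lagrangian
linearized in `u` around the minimizing value `u_{ξ*}`: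
(i) `ξ*` minimizes `η ↦ v_η(t₂)`; (ii) every minimizer of `η ↦ v_η(t₂)` minimizes
`ξ ↦ u_ξ(t₂)`; (iii) if `ξ*` is the unique minimizer of `ξ ↦ u_ξ(t₂)`, the two sets of
minimizers coincide and both equal `{ξ*}`. -/
theorem linearized_herglotz_minimizers
    (n : ℕ) (hn : 1 ≤ n) (K : ℝ) (hK : 0 < K)
    (L Lu : ℝ → EuclideanSpace ℝ (Fin n) → EuclideanSpace ℝ (Fin n) → ℝ → ℝ)
    (hLC1 : ContDiff ℝ 1 fun p : ℝ × EuclideanSpace ℝ (Fin n) × EuclideanSpace ℝ (Fin n) × ℝ =>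
      L p.1 p.2.1 p.2.2.1 p.2.2.2)
    (hLu : ∀ (s : ℝ) (x v : EuclideanSpace ℝ (Fin n)) (u : ℝ),
      HasDerivAt (fun r => L s x v r) (Lu s x v u) u)
    (hLuK : ∀ (s : ℝ) (x v : EuclideanSpace ℝ (Fin n)) (u : ℝ), |Lu s x v u| ≤ K)
    (hconc : ∀ (s : ℝ) (x v : EuclideanSpace ℝ (Fin n)),
      ConcaveOn ℝ univ fun u : ℝ => L s x v u)
    (t₁ t₂ : ℝ) (ht : t₁ < t₂) (x y : EuclideanSpace ℝ (Fin n)) (u₀ : ℝ)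
    (usol : (ℝ → EuclideanSpace ℝ (Fin n)) → (ℝ → EuclideanSpace ℝ (Fin n)) → ℝ → ℝ)
    (husol : ∀ ξ ξ', IsLipCurve n t₁ t₂ ξ ξ' → ξ t₁ = x → ξ t₂ = y →
      IsCaraSol n L t₁ t₂ ξ ξ' u₀ (usol ξ ξ'))
    (ξs ξs' : ℝ → EuclideanSpace ℝ (Fin n))
    (hξs : IsLipCurve n t₁ t₂ ξs ξs' ∧ ξs t₁ = x ∧ ξs t₂ = y)
    (hmin : ∀ p : {p : (ℝ → EuclideanSpace ℝ (Fin n)) × (ℝ → EuclideanSpace ℝ (Fin n)) //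
        IsLipCurve n t₁ t₂ p.1 p.2 ∧ p.1 t₁ = x ∧ p.1 t₂ = y},
      usol ξs ξs' t₂ ≤ usol p.1.1 p.1.2 t₂)
    (vsol : (ℝ → EuclideanSpace ℝ (Fin n)) → (ℝ → EuclideanSpace ℝ (Fin n)) → ℝ → ℝ)
    (hvsol : ∀ η η', IsLipCurve n t₁ t₂ η η' → η t₁ = x → η t₂ = y →
      ContinuousOn (vsol η η') (Icc t₁ t₂) ∧
      IntervalIntegrable (fun τ => L τ (η τ) (η' τ) (usol ξs ξs' τ) +
        Lu τ (η τ) (η' τ) (usol ξs ξs' τ) * (vsol η η' τ - usol ξs ξs' τ)) volume t₁ t₂ ∧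
      ∀ s ∈ Icc t₁ t₂, vsol η η' s = u₀ + ∫ τ in t₁..s,
        (L τ (η τ) (η' τ) (usol ξs ξs' τ) +
          Lu τ (η τ) (η' τ) (usol ξs ξs' τ) * (vsol η η' τ - usol ξs ξs' τ))) :
    -- (i) ξ* minimizes η ↦ v_η(t₂)
    (∀ p : {p : (ℝ → EuclideanSpace ℝ (Fin n)) × (ℝ → EuclideanSpace ℝ (Fin n)) //
        IsLipCurve n t₁ t₂ p.1 p.2 ∧ p.1 t₁ = x ∧ p.1 t₂ = y},
      vsol ξs ξs' t₂ ≤ vsol p.1.1 p.1.2 t₂) ∧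
    -- (ii) every minimizer of η ↦ v_η(t₂) is a minimizer of ξ ↦ u_ξ(t₂)
    (∀ q : {p : (ℝ → EuclideanSpace ℝ (Fin n)) × (ℝ → EuclideanSpace ℝ (Fin n)) //
        IsLipCurve n t₁ t₂ p.1 p.2 ∧ p.1 t₁ = x ∧ p.1 t₂ = y},
      (∀ p : {p : (ℝ → EuclideanSpace ℝ (Fin n)) × (ℝ → EuclideanSpace ℝ (Fin n)) //
          IsLipCurve n t₁ t₂ p.1 p.2 ∧ p.1 t₁ = x ∧ p.1 t₂ = y},
        vsol q.1.1 q.1.2 t₂ ≤ vsol p.1.1 p.1.2 t₂) →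
      (∀ p : {p : (ℝ → EuclideanSpace ℝ (Fin n)) × (ℝ → EuclideanSpace ℝ (Fin n)) //
          IsLipCurve n t₁ t₂ p.1 p.2 ∧ p.1 t₁ = x ∧ p.1 t₂ = y},
        usol q.1.1 q.1.2 t₂ ≤ usol p.1.1 p.1.2 t₂)) ∧
    -- (iii) if ξ* is the unique minimizer of ξ ↦ u_ξ(t₂), then the minimizers of
    -- η ↦ v_η(t₂) and of ξ ↦ u_ξ(t₂) coincide and both sets equal {ξ*}
    ((∀ q : {p : (ℝ → EuclideanSpace ℝ (Fin n)) × (ℝ → EuclideanSpace ℝ (Fin n)) //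
        IsLipCurve n t₁ t₂ p.1 p.2 ∧ p.1 t₁ = x ∧ p.1 t₂ = y},
      (∀ p : {p : (ℝ → EuclideanSpace ℝ (Fin n)) × (ℝ → EuclideanSpace ℝ (Fin n)) //
          IsLipCurve n t₁ t₂ p.1 p.2 ∧ p.1 t₁ = x ∧ p.1 t₂ = y},
        usol q.1.1 q.1.2 t₂ ≤ usol p.1.1 p.1.2 t₂) → EqOn q.1.1 ξs (Icc t₁ t₂)) →
      ∀ q : {p : (ℝ → EuclideanSpace ℝ (Fin n)) × (ℝ → EuclideanSpace ℝ (Fin n)) //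
          IsLipCurve n t₁ t₂ p.1 p.2 ∧ p.1 t₁ = x ∧ p.1 t₂ = y},
        ((∀ p : {p : (ℝ → EuclideanSpace ℝ (Fin n)) × (ℝ → EuclideanSpace ℝ (Fin n)) //
            IsLipCurve n t₁ t₂ p.1 p.2 ∧ p.1 t₁ = x ∧ p.1 t₂ = y},
          vsol q.1.1 q.1.2 t₂ ≤ vsol p.1.1 p.1.2 t₂) ↔
        (∀ p : {p : (ℝ → EuclideanSpace ℝ (Fin n)) × (ℝ → EuclideanSpace ℝ (Fin n)) //
            IsLipCurve n t₁ t₂ p.1 p.2 ∧ p.1 t₁ = x ∧ p.1 t₂ = y},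
          usol q.1.1 q.1.2 t₂ ≤ usol p.1.1 p.1.2 t₂)) ∧
        ((∀ p : {p : (ℝ → EuclideanSpace ℝ (Fin n)) × (ℝ → EuclideanSpace ℝ (Fin n)) //
            IsLipCurve n t₁ t₂ p.1 p.2 ∧ p.1 t₁ = x ∧ p.1 t₂ = y},
          vsol q.1.1 q.1.2 t₂ ≤ vsol p.1.1 p.1.2 t₂) → EqOn q.1.1 ξs (Icc t₁ t₂))) := by
  obtain ⟨hws, hwsi, hws_eq⟩ := husol ξs ξs' hξs.1 hξs.2.1 hξs.2.2
  set w := usol ξs ξs'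
  have hu_le_v : ∀ η η', IsLipCurve n t₁ t₂ η η' → η t₁ = x → η t₂ = y →
      usol η η' t₂ ≤ vsol η η' t₂ := by
    intro η η' hη hx hy
    obtain ⟨huc, hui, hu⟩ := husol η η' hη hx hy
    obtain ⟨hvc, hvi, hv⟩ := hvsol η η' hη hx hy
    have := nonneg_of_eq_integral_of_mul_le hK (hvc.sub huc) (hvi.sub hui)
      (integral_sub_eq hvi hui hv hu)
      (Filter.Eventually.of_forall fun τ _ hτ => by
        simp only [Pi.sub_apply] at hτ ⊢
        have hc := concave_le_tangent (hconc τ (η τ) (η' τ)) (hLu τ (η τ) (η' τ) (w τ))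
          (usol η η' τ)
        nlinarith [le_abs_self (Lu τ (η τ) (η' τ) (w τ)), hLuK τ (η τ) (η' τ) (w τ)])
      t₂ (right_mem_Icc.2 ht.le)
    simpa using this
  have hv_le_w : ∀ η η', IsLipCurve n t₁ t₂ η η' → η t₁ = x → η t₂ = y →
      EqOn η ξs (Icc t₁ t₂) → vsol η η' t₂ ≤ w t₂ := by
    intro η η' hη hx hy heq
    obtain ⟨hvc, hvi, hv⟩ := hvsol η η' hη hx hy
    have hae : ∀ᵐ τ, τ ∈ Icc t₁ t₂ → η' τ = ξs' τ :=
      ae_eq_of_integral_eq hη.2.1 hξs.1.2.1 fun s hs => by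
        have h := heq hs
        rw [hη.2.2 s hs, hξs.1.2.2 s hs, hx, hξs.2.1] at h
        exact add_left_cancel h
    have := nonneg_of_eq_integral_of_mul_le hK (hws.sub hvc) (hwsi.sub hvi)
      (integral_sub_eq hwsi hvi hws_eq hv)
      (by
        filter_upwards [hae] with τ hτ hI hd
        simp only [Pi.sub_apply] at hd ⊢
        rw [hτ hI, heq hI]
        nlinarith [le_abs_self (Lu τ (ξs τ) (ξs' τ) (w τ)), hLuK τ (ξs τ) (ξs' τ) (w τ)])
      t₂ (right_mem_Icc.2 ht.le)
    simpa using this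
  have hvs : vsol ξs ξs' t₂ ≤ w t₂ :=
    hv_le_w ξs ξs' hξs.1 hξs.2.1 hξs.2.2 fun _ _ => rfl
  have hw_le_v (p : {p : (ℝ → EuclideanSpace ℝ (Fin n)) × (ℝ → EuclideanSpace ℝ (Fin n)) //
      IsLipCurve n t₁ t₂ p.1 p.2 ∧ p.1 t₁ = x ∧ p.1 t₂ = y}) : w t₂ ≤ vsol p.1.1 p.1.2 t₂ :=
    (hmin p).trans (hu_le_v _ _ p.2.1 p.2.2.1 p.2.2.2)
  have hu_min_of_hv_min (q : {p : (ℝ → EuclideanSpace ℝ (Fin n)) × (ℝ → EuclideanSpace ℝ (Fin n)) //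
      IsLipCurve n t₁ t₂ p.1 p.2 ∧ p.1 t₁ = x ∧ p.1 t₂ = y})
      (hq : ∀ p : {p : (ℝ → EuclideanSpace ℝ (Fin n)) × (ℝ → EuclideanSpace ℝ (Fin n)) //
        IsLipCurve n t₁ t₂ p.1 p.2 ∧ p.1 t₁ = x ∧ p.1 t₂ = y},
        vsol q.1.1 q.1.2 t₂ ≤ vsol p.1.1 p.1.2 t₂)
      (p : {p : (ℝ → EuclideanSpace ℝ (Fin n)) × (ℝ → EuclideanSpace ℝ (Fin n)) //
        IsLipCurve n t₁ t₂ p.1 p.2 ∧ p.1 t₁ = x ∧ p.1 t₂ = y}) :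
      usol q.1.1 q.1.2 t₂ ≤ usol p.1.1 p.1.2 t₂ :=
    (hu_le_v _ _ q.2.1 q.2.2.1 q.2.2.2).trans
      ((hq ⟨(ξs, ξs'), hξs⟩).trans (hvs.trans (hmin p)))
  refine ⟨fun p => hvs.trans (hw_le_v p), hu_min_of_hv_min, fun huniq q => ⟨⟨hu_min_of_hv_min q, ?_⟩,
    fun hq => huniq q (hu_min_of_hv_min q hq)⟩⟩
  exact fun hq p =>
    (hv_le_w _ _ q.2.1 q.2.2.1 q.2.2.2 (huniq q hq)).trans (hw_le_v p)
end
end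

section
/- Let n ≥ 1, K > 0, and let L : ℝ × ℝⁿ × ℝⁿ × ℝ → ℝ be C¹ with |∂L/∂u| ≤ K everywhere and with u ↦ L(s,x,v,u) concave for every (s,x,v). Fix t₁ < t₂, x, y ∈ ℝⁿ and u₀ ∈ ℝ, and suppose ξ* ∈ Γ^{t₁,t₂}_{x,y} is a minimizer for h_L(t₁,t₂,x,y,u₀); let u_{ξ*} be the corresponding Carathéodory solution with u_{ξ*}(t₁) = u₀. Define L^{ξ*}(s,x,v,u) := L(s,x,v,u_{ξ*}(s)) + (∂L/∂u)(s,x,v,u_{ξ*}(s))·(u − u_{ξ*}(s)). If ξ' ∈ Γ^{t₁,t₂}_{x,y} is a minimizer for h_{L^{ξ*}}(t₁,t₂,x,y,u₀), then ξ' is a minimizer for h_L(t₁,t₂,x,y,u₀). -/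
open MeasureTheory Set

noncomputable section

/-- Tangent line inequality for concave functions. -/
theorem ConcaveOn.le_add_mul_sub_of_hasDerivAt {S : Set ℝ} {f : ℝ → ℝ} {f' x y : ℝ}
    (hf : ConcaveOn ℝ S f) (hx : x ∈ S) (hy : y ∈ S) (hf' : HasDerivAt f f' x) :
    f y ≤ f x + f' * (y - x) := by
  rcases lt_trichotomy x y with h | rfl | h
  · have h1 := hf.slope_le_of_hasDerivAt hx hy h hf'
    rw [slope_def_field, div_le_iff₀ (sub_pos.2 h)] at h1
    linarith
  · simp
  · have h1 := hf.le_slope_of_hasDerivAt hy hx h hf'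
    rw [slope_def_field, le_div_iff₀ (sub_pos.2 h)] at h1
    linarith

/-- One-sided Grönwall inequality for absolutely continuous functions: if `D` is the primitive of
`g` vanishing at `a` and `g ≤ K |D|`, then `D ≤ 0`. -/
theorem nonpos_of_eq_integral_of_le_mul_abs {a b K : ℝ} (hK : 0 ≤ K) {D g : ℝ → ℝ}
    (hDc : ContinuousOn D (Icc a b)) (hg : IntervalIntegrable g volume a b)
    (hD : ∀ s ∈ Icc a b, D s = ∫ τ in a..s, g τ)
    (hle : ∀ s ∈ Icc a b, g s ≤ K * |D s|) {t : ℝ} (ht : t ∈ Icc a b) : D t ≤ 0 := by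
  have hab : a ≤ b := ht.1.trans ht.2
  set E : ℝ → ℝ := fun s => max 0 (D (projIcc a b hab s)) with hE
  have hEc : Continuous E :=
    continuous_const.max (hDc.domRestrict.comp continuous_projIcc)
  have hEnn : ∀ s, 0 ≤ E s := fun s => le_max_left _ _
  have hED : ∀ s ∈ Icc a b, E s = max 0 (D s) := fun s hs => by
    simp only [hE, projIcc_of_mem hab hs]
  have hEi : ∀ r s, IntervalIntegrable E volume r s := fun r s => hEc.intervalIntegrable r s
  have hgi : ∀ r ∈ Icc a b, ∀ s ∈ Icc a b, IntervalIntegrable g volume r s := fun r hr s hs =>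
    hg.mono_set (by rw [uIcc_of_le hab]; exact uIcc_subset_Icc hr hs)
  have ha : a ∈ Icc a b := left_mem_Icc.2 hab
  set F : ℝ → ℝ := fun s => ∫ τ in a..s, E τ with hF
  have hFd : ∀ s, HasDerivAt F (E s) s := fun s =>
    intervalIntegral.integral_hasDerivAt_right (hEi a s)
      hEc.stronglyMeasurable.stronglyMeasurableAtFilter hEc.continuousAt
  have hFnn : ∀ s ∈ Icc a b, 0 ≤ F s := fun s hs =>
    intervalIntegral.integral_nonneg hs.1 fun u _ => hEnn u
  have key : ∀ s ∈ Icc a b, E s ≤ K * F s := by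
    intro s hs
    rw [hED s hs]
    refine max_le (mul_nonneg hK (hFnn s hs)) ?_
    obtain ⟨r, ⟨hr, hrD⟩, hmax⟩ : ∃ r, IsGreatest {r | r ∈ Icc a s ∧ E r ≤ 0} r := by
      refine IsCompact.exists_isGreatest ?_ ⟨a, left_mem_Icc.2 hs.1, ?_⟩
      · exact isCompact_Icc.inter_right (isClosed_le hEc continuous_const)
      · simp [hED a ha, hD a ha]
    have hrb : r ∈ Icc a b := ⟨hr.1, hr.2.trans hs.2⟩
    have hDr : D r ≤ 0 := (le_max_right _ _).trans ((hED r hrb).symm.le.trans hrD)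
    have h1 : (∫ τ in r..s, g τ) ≤ ∫ τ in r..s, K * E τ := by
      refine intervalIntegral.integral_mono_on_of_le_Ioo hr.2 (hgi r hrb s hs)
        ((hEi r s).const_mul K) fun τ hτ => ?_
      have hτb : τ ∈ Icc a b := ⟨hr.1.trans hτ.1.le, hτ.2.le.trans hs.2⟩
      have hpos : 0 < E τ := by
        by_contra! h
        exact (hmax ⟨⟨hτb.1, hτ.2.le⟩, h⟩).not_gt hτ.1
      have hDpos : 0 < D τ := by simpa [hED τ hτb] using hpos
      have h2 := hle τ hτb
      rwa [abs_of_pos hDpos, ← max_eq_right hDpos.le, ← hED τ hτb] at h2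
    have h2 : D s = D r + ∫ τ in r..s, g τ := by
      rw [hD s hs, hD r hrb,
        intervalIntegral.integral_add_adjacent_intervals (hgi a ha r hrb) (hgi r hrb s hs)]
    have h3 : F s = F r + ∫ τ in r..s, E τ :=
      (intervalIntegral.integral_add_adjacent_intervals (hEi a r) (hEi r s)).symm
    rw [intervalIntegral.integral_const_mul] at h1
    nlinarith [mul_nonneg hK (hFnn r hrb)]
  have hF0 : F t = 0 := by
    refine eq_zero_of_abs_deriv_le_mul_abs_self_of_eq_zero_right (f := F) (f' := E) (K := K)
      (fun s _ => (hFd s).continuousAt.continuousWithinAt)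
      (fun s _ => (hFd s).hasDerivWithinAt) (by simp [hF]) (fun s hs => ?_) t ht
    have hs' := Ico_subset_Icc_self hs
    rw [Real.norm_of_nonneg (hEnn s), Real.norm_of_nonneg (hFnn s hs')]
    exact key s hs'
  have h := key t ht
  rw [hED t ht, hF0, mul_zero] at h
  exact (le_max_right _ _).trans h

/-- Comparison principle for two Carathéodory solutions (for possibly different Lagrangians) along
the same curve, with the same initial value. -/
theorem IsCaraSol.le_of_sub_le_mul_abs {n : ℕ}
    {M N : ℝ → EuclideanSpace ℝ (Fin n) → EuclideanSpace ℝ (Fin n) → ℝ → ℝ}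
    {a b K u₀ : ℝ} (hK : 0 ≤ K) {ξ ξ' : ℝ → EuclideanSpace ℝ (Fin n)} {v w : ℝ → ℝ}
    (hv : IsCaraSol n M a b ξ ξ' u₀ v) (hw : IsCaraSol n N a b ξ ξ' u₀ w)
    (h : ∀ s ∈ Icc a b,
      M s (ξ s) (ξ' s) (v s) - N s (ξ s) (ξ' s) (w s) ≤ K * |v s - w s|)
    {t : ℝ} (ht : t ∈ Icc a b) : v t ≤ w t := by
  refine sub_nonpos.1 (nonpos_of_eq_integral_of_le_mul_abs hK (D := fun s => v s - w s)
    (hv.1.sub hw.1) (hv.2.1.sub hw.2.1) (fun s hs => ?_) h ht)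
  have hsub : uIcc a s ⊆ uIcc a b := uIcc_subset_uIcc_left (Icc_subset_uIcc hs)
  rw [intervalIntegral.integral_sub (hv.2.1.mono_set hsub) (hw.2.1.mono_set hsub)]
  linarith [hv.2.2 s hs, hw.2.2 s hs]

/-- **Proposition 2.5 (2)**: if `ξ*` is a minimizer for `h_L(t₁,t₂,x,y,u₀)` and `ζ` is a
minimizer for `h_{L^{ξ*}}(t₁,t₂,x,y,u₀)`, where `L^{ξ*}` is the Lagrangian linearized in `u`
around `u_{ξ*}`, then `ζ` is a minimizer for `h_L(t₁,t₂,x,y,u₀)`. -/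
theorem linearized_minimizer_is_minimizer
    (n : ℕ) (hn : 1 ≤ n) (K : ℝ) (hK : 0 < K)
    (L Lu : ℝ → EuclideanSpace ℝ (Fin n) → EuclideanSpace ℝ (Fin n) → ℝ → ℝ)
    (hLC1 : ContDiff ℝ 1 fun p : ℝ × EuclideanSpace ℝ (Fin n) × EuclideanSpace ℝ (Fin n) × ℝ =>
      L p.1 p.2.1 p.2.2.1 p.2.2.2)
    (hLu : ∀ (s : ℝ) (x v : EuclideanSpace ℝ (Fin n)) (u : ℝ),
      HasDerivAt (fun r => L s x v r) (Lu s x v u) u)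
    (hLuK : ∀ (s : ℝ) (x v : EuclideanSpace ℝ (Fin n)) (u : ℝ), |Lu s x v u| ≤ K)
    (hconc : ∀ (s : ℝ) (x v : EuclideanSpace ℝ (Fin n)),
      ConcaveOn ℝ univ fun u : ℝ => L s x v u)
    (t₁ t₂ : ℝ) (ht : t₁ < t₂) (x y : EuclideanSpace ℝ (Fin n)) (u₀ : ℝ)
    (usol : (ℝ → EuclideanSpace ℝ (Fin n)) → (ℝ → EuclideanSpace ℝ (Fin n)) → ℝ → ℝ)
    (husol : ∀ ξ ξ', IsLipCurve n t₁ t₂ ξ ξ' → ξ t₁ = x → ξ t₂ = y →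
      IsCaraSol n L t₁ t₂ ξ ξ' u₀ (usol ξ ξ'))
    (ξs ξs' : ℝ → EuclideanSpace ℝ (Fin n))
    (hξs : IsLipCurve n t₁ t₂ ξs ξs' ∧ ξs t₁ = x ∧ ξs t₂ = y)
    (hmin : ∀ p : {p : (ℝ → EuclideanSpace ℝ (Fin n)) × (ℝ → EuclideanSpace ℝ (Fin n)) //
        IsLipCurve n t₁ t₂ p.1 p.2 ∧ p.1 t₁ = x ∧ p.1 t₂ = y},
      (∫ s in t₁..t₂, L s (ξs s) (ξs' s) (usol ξs ξs' s)) ≤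
        ∫ s in t₁..t₂, L s (p.1.1 s) (p.1.2 s) (usol p.1.1 p.1.2 s))
    (vsol : (ℝ → EuclideanSpace ℝ (Fin n)) → (ℝ → EuclideanSpace ℝ (Fin n)) → ℝ → ℝ)
    (hvsol : ∀ η η', IsLipCurve n t₁ t₂ η η' → η t₁ = x → η t₂ = y →
      IsCaraSol n (fun s z v u => L s z v (usol ξs ξs' s) +
          Lu s z v (usol ξs ξs' s) * (u - usol ξs ξs' s))
        t₁ t₂ η η' u₀ (vsol η η'))
    (ζ ζ' : ℝ → EuclideanSpace ℝ (Fin n))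
    (hζ : IsLipCurve n t₁ t₂ ζ ζ' ∧ ζ t₁ = x ∧ ζ t₂ = y)
    (hζmin : ∀ p : {p : (ℝ → EuclideanSpace ℝ (Fin n)) × (ℝ → EuclideanSpace ℝ (Fin n)) //
        IsLipCurve n t₁ t₂ p.1 p.2 ∧ p.1 t₁ = x ∧ p.1 t₂ = y},
      (∫ s in t₁..t₂, (L s (ζ s) (ζ' s) (usol ξs ξs' s) +
          Lu s (ζ s) (ζ' s) (usol ξs ξs' s) * (vsol ζ ζ' s - usol ξs ξs' s))) ≤
        ∫ s in t₁..t₂, (L s (p.1.1 s) (p.1.2 s) (usol ξs ξs' s) +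
          Lu s (p.1.1 s) (p.1.2 s) (usol ξs ξs' s) * (vsol p.1.1 p.1.2 s - usol ξs ξs' s))) :
    ∀ p : {p : (ℝ → EuclideanSpace ℝ (Fin n)) × (ℝ → EuclideanSpace ℝ (Fin n)) //
        IsLipCurve n t₁ t₂ p.1 p.2 ∧ p.1 t₁ = x ∧ p.1 t₂ = y},
      (∫ s in t₁..t₂, L s (ζ s) (ζ' s) (usol ζ ζ' s)) ≤
        ∫ s in t₁..t₂, L s (p.1.1 s) (p.1.2 s) (usol p.1.1 p.1.2 s) := by
  intro p
  have hb : t₂ ∈ Icc t₁ t₂ := right_mem_Icc.2 ht.le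
  have hbound : ∀ s (z v : EuclideanSpace ℝ (Fin n)) u d, Lu s z v u * d ≤ K * |d| :=
    fun s z v u d => (le_abs_self _).trans (by
      rw [abs_mul]; exact mul_le_mul_of_nonneg_right (hLuK s z v u) (abs_nonneg d))
  have hus := husol ξs ξs' hξs.1 hξs.2.1 hξs.2.2
  have hvs := hvsol ξs ξs' hξs.1 hξs.2.1 hξs.2.2
  have huζ := husol ζ ζ' hζ.1 hζ.2.1 hζ.2.2
  have hvζ := hvsol ζ ζ' hζ.1 hζ.2.1 hζ.2.2
  have hle_star : vsol ξs ξs' t₂ ≤ usol ξs ξs' t₂ := by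
    refine hvs.le_of_sub_le_mul_abs hK.le hus (fun s _ => ?_) hb
    rw [add_sub_cancel_left]
    exact hbound _ _ _ _ _
  have hle_lin : usol ζ ζ' t₂ ≤ vsol ζ ζ' t₂ := by
    refine huζ.le_of_sub_le_mul_abs hK.le hvζ (fun s _ => ?_) hb
    have htan := (hconc s (ζ s) (ζ' s)).le_add_mul_sub_of_hasDerivAt (mem_univ _)
      (mem_univ (usol ζ ζ' s)) (hLu s (ζ s) (ζ' s) (usol ξs ξs' s))
    have := hbound s (ζ s) (ζ' s) (usol ξs ξs' s) (usol ζ ζ' s - vsol ζ ζ' s)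
    linarith
  have hζs := hζmin ⟨(ξs, ξs'), hξs⟩
  have e₁ := hus.2.2 t₂ hb
  have e₂ := hvs.2.2 t₂ hb
  have e₃ := huζ.2.2 t₂ hb
  have e₄ := hvζ.2.2 t₂ hb
  refine le_trans ?_ (hmin p)
  linarith
end
end

section
/- Let n ≥ 1, λ ∈ ℝ, and let L₀ : ℝⁿ × ℝⁿ → ℝ be continuous. Let φ : ℝⁿ → ℝ, t > 0 and x ∈ ℝⁿ. For a Lipschitz curve ξ : [0,t] → ℝⁿ with ξ(t) = x, let u_ξ : [0,t] → ℝ be the unique continuous solution of u_ξ(s) = φ(ξ(0)) + ∫₀^{s} ( L₀(ξ(τ),ξ'(τ)) − λ·u_ξ(τ) ) dτ. Then, as elements of ℝ ∪ {−∞}, inf over Lipschitz ξ : [0,t] → ℝⁿ with ξ(t) = x of u_ξ(t) equals inf over Lipschitz curves ζ : [−t,0] → ℝⁿ with ζ(0) = x of ( e^{−λt}·φ(ζ(−t)) + ∫_{−t}^{0} e^{λ s}·L₀(ζ(s),ζ'(s)) ds ). -/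
open MeasureTheory Set

noncomputable section

/-- Duhamel's formula for a solution `u` of `u' = ℓ - lam * u` in integral form. -/
theorem eq_exp_mul_add_integral_of_eq_add_integral_sub {lam c t : ℝ} (ht : 0 ≤ t) {u ℓ : ℝ → ℝ}
    (hint : IntervalIntegrable (fun τ => ℓ τ - lam * u τ) volume 0 t)
    (hu : ∀ s ∈ Icc (0:ℝ) t, u s = c + ∫ τ in (0:ℝ)..s, (ℓ τ - lam * u τ)) :
    u t = Real.exp (-(lam * t)) * c + ∫ s in (-t)..(0:ℝ), Real.exp (lam * s) * ℓ (s + t) := by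
  set g : ℝ → ℝ := fun τ => ℓ τ - lam * u τ with hg
  have hG : AbsolutelyContinuousOnInterval (fun s => c + ∫ τ in (0:ℝ)..s, g τ) 0 t := by
    have hconst : AbsolutelyContinuousOnInterval (fun _ : ℝ => c) 0 t :=
      (contDiff_const (n := 1)).contDiffOn.absolutelyContinuousOnInterval
    exact hconst.add (hint.absolutelyContinuousOnInterval_intervalIntegral left_mem_uIcc)
  have hE : AbsolutelyContinuousOnInterval (fun s => Real.exp (lam * s)) 0 t := by
    have hdiff : ContDiff ℝ 1 (fun s : ℝ => Real.exp (lam * s)) := by fun_prop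
    exact hdiff.contDiffOn.absolutelyContinuousOnInterval
  have hparts := hE.integral_deriv_mul_eq_sub hG
  have hcongr : ∫ s in (0:ℝ)..t, Real.exp (lam * s) * ℓ s =
      Real.exp (lam * t) * u t - c := by
    rw [hu t (right_mem_Icc.2 ht)]
    simp only [mul_zero, Real.exp_zero, one_mul, intervalIntegral.integral_same, add_zero] at hparts
    rw [← hparts]
    refine intervalIntegral.integral_congr_ae ?_
    filter_upwards [hint.ae_hasDerivAt_integral] with s hs hst
    have hs' := (hs (uIoc_subset_uIcc hst) 0 left_mem_uIcc).const_add c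
    have hexp : HasDerivAt (fun s => Real.exp (lam * s)) (Real.exp (lam * s) * (lam * 1)) s :=
      ((hasDerivAt_id s).const_mul lam).exp
    have hsI : s ∈ Icc 0 t := uIcc_of_le ht ▸ uIoc_subset_uIcc hst
    rw [hs'.deriv, hexp.deriv, ← hu s hsI]
    simp only [hg]
    ring
  have hshift : ∫ s in (-t)..(0:ℝ), Real.exp (lam * s) * ℓ (s + t) =
      Real.exp (-(lam * t)) * ∫ s in (0:ℝ)..t, Real.exp (lam * s) * ℓ s := by
    rw [← intervalIntegral.integral_const_mul]
    have := intervalIntegral.integral_comp_add_right (a := -t) (b := 0)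
      (fun s => Real.exp (-(lam * t)) * (Real.exp (lam * s) * ℓ s)) t
    rw [neg_add_cancel, zero_add] at this
    rw [← this]
    congr 1 with s
    rw [← mul_assoc, ← Real.exp_add]
    ring_nf
  have hone : Real.exp (-(lam * t)) * Real.exp (lam * t) = 1 := by
    rw [← Real.exp_add, neg_add_cancel, Real.exp_zero]
  rw [hshift, hcongr]
  linear_combination (-u t) * hone

/-- Lipschitz curves are stable under translation of time. -/
theorem IsLipCurve.comp_add_right {n : ℕ} {a b : ℝ} {ξ ξ' : ℝ → EuclideanSpace ℝ (Fin n)}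
    (h : IsLipCurve n a b ξ ξ') (c : ℝ) :
    IsLipCurve n (a - c) (b - c) (fun s => ξ (s + c)) (fun s => ξ' (s + c)) := by
  obtain ⟨⟨C, hC⟩, hint, heq⟩ := h
  have hmem : ∀ {s}, s ∈ Icc (a - c) (b - c) → s + c ∈ Icc a b := fun hs =>
    ⟨by linarith [hs.1], by linarith [hs.2]⟩
  refine ⟨⟨C, fun s hs r hr => ?_⟩, hint.comp_add_right c, fun s hs => ?_⟩
  · simpa using hC (hmem hs) (hmem hr)
  · simpa using heq (s + c) (hmem hs)

/-- **Corollary 4.1 (discounted evolutionary equation)**: for the discounted Lagrangian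
`L(x,v,u) = L₀(x,v) − λu`, the Herglotz value `inf_{ξ ∈ A_{t,x}} u_ξ(t)` equals, in
`ℝ ∪ {−∞}`, the classical discounted value
`inf_ζ ( e^{−λt} φ(ζ(−t)) + ∫_{−t}^0 e^{λs} L₀(ζ(s),ζ'(s)) ds )` over Lipschitz curves
`ζ : [−t,0] → ℝⁿ` with `ζ(0) = x`. -/
theorem discounted_evolution_representation
    (n : ℕ) (hn : 1 ≤ n) (lam : ℝ)
    (L₀ : EuclideanSpace ℝ (Fin n) → EuclideanSpace ℝ (Fin n) → ℝ)
    (hL₀ : Continuous fun p : EuclideanSpace ℝ (Fin n) × EuclideanSpace ℝ (Fin n) =>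
      L₀ p.1 p.2)
    (φ : EuclideanSpace ℝ (Fin n) → ℝ) (t : ℝ) (ht : 0 < t) (x : EuclideanSpace ℝ (Fin n))
    (usol : (ℝ → EuclideanSpace ℝ (Fin n)) → (ℝ → EuclideanSpace ℝ (Fin n)) → ℝ → ℝ)
    (husol : ∀ ξ ξ', IsLipCurve n 0 t ξ ξ' → ξ t = x →
      ContinuousOn (usol ξ ξ') (Icc 0 t) ∧
      IntervalIntegrable (fun τ => L₀ (ξ τ) (ξ' τ) - lam * usol ξ ξ' τ) volume 0 t ∧
      ∀ s ∈ Icc (0:ℝ) t, usol ξ ξ' s =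
        φ (ξ 0) + ∫ τ in (0:ℝ)..s, (L₀ (ξ τ) (ξ' τ) - lam * usol ξ ξ' τ)) :
    (⨅ p : {p : (ℝ → EuclideanSpace ℝ (Fin n)) × (ℝ → EuclideanSpace ℝ (Fin n)) //
        IsLipCurve n 0 t p.1 p.2 ∧ p.1 t = x},
      ((usol p.1.1 p.1.2 t : ℝ) : EReal)) =
    ⨅ q : {q : (ℝ → EuclideanSpace ℝ (Fin n)) × (ℝ → EuclideanSpace ℝ (Fin n)) //
        IsLipCurve n (-t) 0 q.1 q.2 ∧ q.1 0 = x},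
      (((Real.exp (-(lam * t)) * φ (q.1.1 (-t)) +
          ∫ s in (-t)..(0:ℝ), Real.exp (lam * s) * L₀ (q.1.1 s) (q.1.2 s)) : ℝ) : EReal) := by
  have hval : ∀ ξ ξ', IsLipCurve n 0 t ξ ξ' → ξ t = x →
      usol ξ ξ' t = Real.exp (-(lam * t)) * φ (ξ 0) +
        ∫ s in (-t)..(0:ℝ), Real.exp (lam * s) * L₀ (ξ (s + t)) (ξ' (s + t)) := by
    intro ξ ξ' hξ hξt
    obtain ⟨-, hint, hu⟩ := husol ξ ξ' hξ hξt
    exact eq_exp_mul_add_integral_of_eq_add_integral_sub ht.le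
      (ℓ := fun τ => L₀ (ξ τ) (ξ' τ)) hint hu
  refine le_antisymm (le_iInf ?_) (le_iInf ?_)
  · rintro ⟨⟨ζ, ζ'⟩, hζ, hζ0⟩
    have hξ : IsLipCurve n 0 t (fun s => ζ (s + -t)) (fun s => ζ' (s + -t)) := by
      simpa using hζ.comp_add_right (-t)
    have hξt : ζ (t + -t) = x := by simpa using hζ0
    refine (iInf_le _ ⟨(_, _), hξ, hξt⟩).trans_eq ?_
    simp [hval _ _ hξ hξt]
  · rintro ⟨⟨ξ, ξ'⟩, hξ, hξt⟩
    have hζ : IsLipCurve n (-t) 0 (fun s => ξ (s + t)) (fun s => ξ' (s + t)) := by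
      simpa using hξ.comp_add_right t
    have hζ0 : ξ (0 + t) = x := by simpa using hξt
    refine (iInf_le _ ⟨(_, _), hζ, hζ0⟩).trans_eq ?_
    simp [hval _ _ hξ hξt]
end
end

section
/- Let t > 0 and let G : ℝ × ℝ → ℝ be continuous, with the partial derivative ∂G/∂u in the second variable existing and continuous on ℝ × ℝ. Let u : [0,t] → ℝ be absolutely continuous with u̇(s) = G(s,u(s)) for a.e. s ∈ [0,t]. Define â(s) := ∫₀¹ (∂G/∂u)(s, λ·u(s)) dλ for s ∈ [0,t]. Then u(t) = exp(∫₀^{t} â(τ) dτ)·u(0) + ∫₀^{t} exp(∫_{s}^{t} â(τ) dτ)·G(s,0) ds. -/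
open MeasureTheory Set

noncomputable section

/-- **Variation of constants** for a scalar linear equation with continuous coefficients. -/
theorem variation_of_constants {a g w : ℝ → ℝ} {x t : ℝ} (ha : Continuous a) (hg : Continuous g)
    (hw : ∀ s ∈ uIcc x t, HasDerivAt w (g s + a s * w s) s) :
    w t = Real.exp (∫ τ in x..t, a τ) * w x +
      ∫ s in x..t, Real.exp (∫ τ in s..t, a τ) * g s := by
  have hA : ∀ s, HasDerivAt (fun r => ∫ τ in r..t, a τ) (-a s) s := fun s =>
    intervalIntegral.integral_hasDerivAt_left (ha.intervalIntegrable _ _)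
      (ha.stronglyMeasurableAtFilter _ _) ha.continuousAt
  have hAcont : Continuous fun r => ∫ τ in r..t, a τ :=
    continuous_iff_continuousAt.2 fun s => (hA s).continuousAt
  have hF : ∀ s ∈ uIcc x t, HasDerivAt (fun r => Real.exp (∫ τ in r..t, a τ) * w r)
      (Real.exp (∫ τ in s..t, a τ) * g s) s := fun s hs => by
    refine ((hA s).exp.mul (hw s hs)).congr_deriv ?_
    ring
  have key := intervalIntegral.integral_eq_sub_of_hasDerivAt hF
    ((hAcont.rexp.mul hg).intervalIntegrable _ _)
  rw [key]
  simp

/-- **Hadamard's lemma** in one variable, based at the origin. -/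
theorem eq_add_integral_deriv_mul {f f' : ℝ → ℝ} (hf : ∀ r, HasDerivAt f (f' r) r)
    (hf' : Continuous f') (r : ℝ) :
    f r = f 0 + (∫ l in (0 : ℝ)..1, f' (l * r)) * r := by
  have hderiv : ∀ l ∈ uIcc (0 : ℝ) 1, HasDerivAt (fun l => f (l * r)) (f' (l * r) * r) l :=
    fun l _ => (hf (l * r)).comp l (by simpa using (hasDerivAt_id l).mul_const r)
  have key := intervalIntegral.integral_eq_sub_of_hasDerivAt hderiv
    (Continuous.intervalIntegrable (by fun_prop) _ _)
  rw [← intervalIntegral.integral_mul_const, key]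
  simp

/-- **Hadamard-splitting representation** from the concluding remarks: if `u` is absolutely
continuous on `[0,t]` with `u̇(s) = G(s,u(s))` a.e., and
`â(s) = ∫₀¹ ∂_u G(s, λ u(s)) dλ`, then
`u(t) = e^{∫₀ᵗ â} u(0) + ∫₀ᵗ e^{∫ₛᵗ â} G(s,0) ds`. -/
theorem hadamard_splitting_representation
    (t : ℝ) (ht : 0 < t)
    (G Gu : ℝ → ℝ → ℝ)
    (hGcont : Continuous fun p : ℝ × ℝ => G p.1 p.2)
    (hGu : ∀ s r : ℝ, HasDerivAt (fun z => G s z) (Gu s r) r)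
    (hGucont : Continuous fun p : ℝ × ℝ => Gu p.1 p.2)
    (u u' : ℝ → ℝ)
    (hu'int : IntervalIntegrable u' volume 0 t)
    (hAC : ∀ s ∈ Icc (0:ℝ) t, u s = u 0 + ∫ τ in (0:ℝ)..s, u' τ)
    (hODE : ∀ᵐ s ∂volume, s ∈ Icc (0:ℝ) t → u' s = G s (u s)) :
    u t = Real.exp (∫ τ in (0:ℝ)..t, ∫ l in (0:ℝ)..1, Gu τ (l * u τ)) * u 0 +
      ∫ s in (0:ℝ)..t,
        Real.exp (∫ τ in s..t, ∫ l in (0:ℝ)..1, Gu τ (l * u τ)) * G s 0 := by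
  have hu : ContinuousOn u (Icc 0 t) := by
    have h := intervalIntegral.continuousOn_primitive_interval' hu'int left_mem_uIcc
    rw [uIcc_of_le ht.le] at h
    exact (continuousOn_const.add h).congr hAC
  obtain ⟨v, hv, hvu⟩ : ∃ v : ℝ → ℝ, Continuous v ∧ ∀ s ∈ Icc 0 t, v s = u s :=
    ⟨IccExtend ht.le ((Icc 0 t).domRestrict u), hu.domRestrict.Icc_extend',
      fun s hs => IccExtend_of_mem ht.le _ hs⟩
  have ha : Continuous fun τ => ∫ l in (0 : ℝ)..1, Gu τ (l * v τ) := by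
    refine intervalIntegral.continuous_parametric_intervalIntegral_of_continuous' ?_ 0 1
    exact hGucont.comp (f := fun q : ℝ × ℝ => (q.1, q.2 * v q.1)) (by fun_prop)
  have hg : Continuous fun s => G s 0 :=
    hGcont.comp (f := fun s : ℝ => (s, (0 : ℝ))) (by fun_prop)
  have hGv : Continuous fun s => G s (v s) :=
    hGcont.comp (f := fun s : ℝ => (s, v s)) (by fun_prop)
  have hwu : ∀ s ∈ Icc 0 t, u 0 + ∫ τ in (0 : ℝ)..s, G τ (v τ) = u s := fun s hs => by
    rw [hAC s hs]
    congr 1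
    refine intervalIntegral.integral_congr_ae ?_
    filter_upwards [hODE] with τ hτ hmem
    rw [uIoc_of_le hs.1] at hmem
    have hτt : τ ∈ Icc 0 t := ⟨hmem.1.le, hmem.2.trans hs.2⟩
    rw [hτ hτt, hvu τ hτt]
  have hw : ∀ s ∈ uIcc 0 t, HasDerivAt (fun s => u 0 + ∫ τ in (0 : ℝ)..s, G τ (v τ))
      (G s 0 + (∫ l in (0 : ℝ)..1, Gu s (l * v s)) *
        (u 0 + ∫ τ in (0 : ℝ)..s, G τ (v τ))) s := fun s hs => by
    rw [uIcc_of_le ht.le] at hs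
    rw [hwu s hs, ← hvu s hs, ← eq_add_integral_deriv_mul (hGu s)
      (hGucont.comp (f := fun r : ℝ => (s, r)) (by fun_prop)) (v s)]
    exact (hGv.integral_hasStrictDerivAt 0 s).hasDerivAt.const_add (u 0)
  have hav : ∀ s ∈ Icc 0 t, ∫ τ in s..t, ∫ l in (0 : ℝ)..1, Gu τ (l * u τ) =
      ∫ τ in s..t, ∫ l in (0 : ℝ)..1, Gu τ (l * v τ) := fun s hs => by
    refine intervalIntegral.integral_congr fun τ hτ => ?_
    rw [uIcc_of_le hs.2] at hτ
    simp only [hvu τ ⟨hs.1.trans hτ.1, hτ.2⟩]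
  have key := variation_of_constants ha hg hw
  rw [hwu t (right_mem_Icc.2 ht.le), hwu 0 (left_mem_Icc.2 ht.le)] at key
  rw [key, hav 0 (left_mem_Icc.2 ht.le)]
  congr 1
  refine intervalIntegral.integral_congr fun s hs => ?_
  rw [uIcc_of_le ht.le] at hs
  simp only [hav s hs]
end
end
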